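/- Let R be a Noetherian local ring with infinite residue field and E a finitely generated R-module. Then: (a) all minimal reductions of E have the same minimal number of generators, equal to the analytic spread ℓ(E); (b) ℓ(E) ≤ μ(E), with equality if and only if E has no proper reductions. -/

import Mathlib

open scoped TensorProduct

noncomputable section

universe u

section Defs
variable (R : Type u) [CommRing R]

/-- The total ring of fractions of `R`. -/
abbrev TotalQuot := Localization (nonZeroDivisors R)

/-- `E` has rank `e`: `E ⊗_R Quot(R)` is free of rank `e` over the total quotient ring. -/
def HasRank (E : Type u) [AddCommGroup E] [Module R E] (e : ℕ) : Prop :=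
  Nonempty ((TotalQuot R ⊗[R] E) ≃ₗ[TotalQuot R] (Fin e → TotalQuot R))

/-- Complement of a prime ideal, with the primality hypothesis explicit. -/
def primeCompl' (p : Ideal R) (hp : p.IsPrime) : Submonoid R :=
  @Ideal.primeCompl R _ p hp

/-- Minimal number of generators of a module. -/
def minGens (E : Type u) [AddCommGroup E] [Module R E] : ℕ :=
  sInf {n | ∃ f : Fin n → E, Submodule.span R (Set.range f) = ⊤}

/-- The grade of an ideal `I` on a module `M`: supremum of lengths of
`M`-regular sequences contained in `I`. -/
def sequenceGrade (I : Ideal R) (M : Type u) [AddCommGroup M] [Module R M] : ℕ∞ :=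
  sSup {n : ℕ∞ | ∃ rs : List R, (rs.length : ℕ∞) = n ∧ (∀ r ∈ rs, r ∈ I) ∧
    RingTheory.Sequence.IsRegular M rs}

/-- Depth of a module over a local ring. -/
def moduleDepth [IsLocalRing R] (M : Type u) [AddCommGroup M] [Module R M] : ℕ∞ :=
  sequenceGrade R (IsLocalRing.maximalIdeal R) M

/-- The grade of a module: grade of its annihilator on `R`. -/
def moduleGrade (M : Type u) [AddCommGroup M] [Module R M] : ℕ∞ :=
  sequenceGrade R (Module.annihilator R M) R

/-- Dimension of a module: Krull dimension of `R` modulo the annihilator. -/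
def moduleDim (M : Type u) [AddCommGroup M] [Module R M] : WithBot ℕ∞ :=
  ringKrullDim (R ⧸ Module.annihilator R M)

/-- Krull dimension of the localization `R_p`. -/
def localDimAt (p : Ideal R) (hp : p.IsPrime) : WithBot ℕ∞ :=
  ringKrullDim (Localization (primeCompl' R p hp))

/-- Height of an ideal: infimum of `dim R_p` over primes `p ⊇ I`. -/
def idealHeight (I : Ideal R) : WithBot ℕ∞ :=
  sInf {d | ∃ (p : Ideal R) (hp : p.IsPrime), I ≤ p ∧ d = localDimAt R p hp}

/-- A local ring is Cohen-Macaulay if its depth equals its dimension. -/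
def IsCMLocalRing [IsLocalRing R] : Prop :=
  (moduleDepth R R : WithBot ℕ∞) = ringKrullDim R

/-- A ring is Cohen-Macaulay if all its localizations at maximal ideals are. -/
def IsCMRing : Prop :=
  ∀ (p : Ideal R), ∀ hp : p.IsMaximal,
    letI : p.IsPrime := hp.isPrime
    (moduleDepth (Localization.AtPrime p) (Localization.AtPrime p) : WithBot ℕ∞)
      = ringKrullDim (Localization.AtPrime p)

/-- A finite module over a local ring is Cohen-Macaulay if it is zero or
its depth equals its dimension. -/
def IsCMModule [IsLocalRing R] (M : Type u) [AddCommGroup M] [Module R M] : Prop :=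
  Subsingleton M ∨ (moduleDepth R M : WithBot ℕ∞) = moduleDim R M

open CategoryTheory in
/-- Vanishing of `Ext_R^n(M, N)`. -/
def extVanish (M N : Type u) [AddCommGroup M] [Module R M] [AddCommGroup N] [Module R N]
    (n : ℕ) : Prop :=
  Subsingleton (((Ext R (ModuleCat.{u} R) n).obj (Opposite.op (ModuleCat.of R M))).obj
    (ModuleCat.of R N))

/-- A Noetherian local ring is Gorenstein iff it is Cohen-Macaulay and `R` has finite
injective dimension, i.e. `Ext^i(k, R) = 0` for all large `i`. -/
def IsGorensteinLocalRing [IsLocalRing R] : Prop :=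
  IsCMLocalRing R ∧ ∃ n : ℕ, ∀ i : ℕ, n < i → extVanish R (IsLocalRing.ResidueField R) R i

variable (E : Type u) [AddCommGroup E] [Module R E]

/-- Defining relations of the symmetric algebra, presented as the free commutative
`R`-algebra on `E` modulo linearity relations. -/
def symRels : Set (MvPolynomial E R) :=
  {p | ∃ x y : E, p = MvPolynomial.X (x + y) - MvPolynomial.X x - MvPolynomial.X y} ∪
  {p | ∃ (r : R) (x : E), p = MvPolynomial.X (r • x) - MvPolynomial.C r * MvPolynomial.X x}

/-- The symmetric algebra of a module. -/
abbrev SymModAlg := MvPolynomial E R ⧸ Ideal.span (symRels R E)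

/-- The `R`-torsion ideal of an `R`-algebra `A`. -/
def torsionIdeal (A : Type u) [CommRing A] [Algebra R A] : Ideal A where
  carrier := {a | ∃ r ∈ nonZeroDivisors R, r • a = 0}
  zero_mem' := ⟨1, one_mem _, smul_zero _⟩
  add_mem' := by
    rintro a b ⟨r, hr, ha⟩ ⟨s, hs, hb⟩
    refine ⟨r * s, mul_mem hr hs, ?_⟩
    have h1 : (r * s) • a = 0 := by rw [mul_comm, mul_smul, ha, smul_zero]
    have h2 : (r * s) • b = 0 := by rw [mul_smul, hb, smul_zero]
    rw [smul_add, h1, h2, add_zero]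
  smul_mem' := by
    rintro c a ⟨r, hr, ha⟩
    exact ⟨r, hr, by rw [smul_comm, ha, smul_zero]⟩

/-- The Rees algebra of a module: the symmetric algebra modulo `R`-torsion. -/
abbrev ReesModAlg := SymModAlg R E ⧸ torsionIdeal R (SymModAlg R E)

/-- The canonical map `E → R(E)`. -/
def reesι (x : E) : ReesModAlg R E :=
  Ideal.Quotient.mk _ (Ideal.Quotient.mk _ (MvPolynomial.X x))

/-- The `j`-th power `E^j` of a module: the `j`-th graded component of its Rees
algebra, i.e. the `R`-span of products of `j` elements of `E`. -/
def reesPower (j : ℕ) : Submodule R (ReesModAlg R E) :=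
  Submodule.span R {a | ∃ f : Fin j → E, a = ∏ i, reesι R E (f i)}

/-- A module is of linear type if its symmetric algebra is `R`-torsion-free,
i.e. the natural surjection `S(E) → R(E)` is an isomorphism. -/
def IsLinearType : Prop := torsionIdeal R (SymModAlg R E) = ⊥

/-- The extension of the maximal ideal to the Rees algebra. -/
def fiberIdeal [IsLocalRing R] : Ideal (ReesModAlg R E) :=
  Ideal.map (algebraMap R (ReesModAlg R E)) (IsLocalRing.maximalIdeal R)

/-- The analytic spread: Krull dimension of the special fiber ring `R(E) ⊗ k`. -/
def analyticSpread [IsLocalRing R] : WithBot ℕ∞ :=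
  ringKrullDim (ReesModAlg R E ⧸ fiberIdeal R E)

/-- The submodule `U·E^r` of the Rees algebra. -/
def mulPower (U : Submodule R E) (r : ℕ) : Submodule R (ReesModAlg R E) :=
  Submodule.span R {a | ∃ u ∈ U, ∃ f : Fin r → E, a = reesι R E u * ∏ i, reesι R E (f i)}

/-- `U` is a reduction of `E` if `E^{r+1} = U·E^r` for some `r`. -/
def IsReduction (U : Submodule R E) : Prop :=
  ∃ r : ℕ, reesPower R E (r + 1) = mulPower R E U r

/-- A minimal reduction. -/
def IsMinimalReduction (U : Submodule R E) : Prop :=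
  IsReduction R E U ∧ ∀ U' : Submodule R E, U' ≤ U → IsReduction R E U' → U' = U

/-- The reduction number of a reduction `U`. -/
def reductionNumberOf (U : Submodule R E) : ℕ :=
  sInf {r | reesPower R E (r + 1) = mulPower R E U r}

/-- The reduction number of `E`. -/
def reductionNumber : ℕ :=
  sInf {r | ∃ U : Submodule R E, IsMinimalReduction R E U ∧ reductionNumberOf R E U = r}

/-- The condition `G_s` for a module of rank `e`:
`μ(E_p) ≤ dim R_p + e - 1` for all primes with `1 ≤ dim R_p ≤ s - 1`. -/
def Gcond (e s : ℕ) : Prop :=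
  ∀ (p : Ideal R) (hp : p.IsPrime),
    (1 : WithBot ℕ∞) ≤ localDimAt R p hp → localDimAt R p hp + 1 ≤ (s : WithBot ℕ∞) →
    (minGens (Localization (primeCompl' R p hp)) (LocalizedModule (primeCompl' R p hp) E)
        : WithBot ℕ∞) ≤ localDimAt R p hp + ((e - 1 : ℕ) : WithBot ℕ∞)

/-- The condition `G_∞` for a module of rank `e`. -/
def GcondInf (e : ℕ) : Prop := ∀ s : ℕ, Gcond R E e s

/-- The condition `G_s` for an ideal: `μ(I_p) ≤ dim R_p` for all primes `p ⊇ I`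
with `dim R_p ≤ s - 1`. -/
def GcondIdeal (I : Ideal R) (s : ℕ) : Prop :=
  ∀ (p : Ideal R) (hp : p.IsPrime), I ≤ p → localDimAt R p hp + 1 ≤ (s : WithBot ℕ∞) →
    (minGens (Localization (primeCompl' R p hp)) (LocalizedModule (primeCompl' R p hp) ↥I)
        : WithBot ℕ∞) ≤ localDimAt R p hp

/-- The `0`-th Fitting ideal of a module. -/
def fitting0 (M : Type u) [AddCommGroup M] [Module R M] : Ideal R :=
  ⨆ (n : ℕ) (π : (Fin n → R) →ₗ[R] M) (_ : Function.Surjective π),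
    Ideal.span {d | ∃ A : Matrix (Fin n) (Fin n) R,
      (∀ jc : Fin n, π (fun i => A i jc) = 0) ∧ d = A.det}

end Defs
open Polynomial in
theorem dim_le_of_integral {P F : Type*} [CommRing P] [CommRing F] [Algebra P F]
    [Algebra.IsIntegral P F] : ringKrullDim F ≤ ringKrullDim P := by
  refine Order.krullDim_le_of_strictMono (PrimeSpectrum.comap (algebraMap P F)) ?_
  intro a b h
  exact Ideal.IsIntegral.comap_lt_comap (R := P) (I := a.asIdeal) (J := b.asIdeal) h

theorem dim_ge_of_integral {P F : Type*} [CommRing P] [CommRing F] [Algebra P F]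
    [Algebra.IsIntegral P F] (hinj : Function.Injective (algebraMap P F)) :
    ringKrullDim P ≤ ringKrullDim F := by
  refine iSup_le fun l => ?_
  have key : ∀ l : LTSeries (PrimeSpectrum P), ∃ l' : LTSeries (PrimeSpectrum F),
      l'.length = l.length ∧ PrimeSpectrum.comap (algebraMap P F) l'.last = l.last := by
    intro l
    induction l using RelSeries.inductionOn' with
    | singleton x =>
      obtain ⟨Q, _, hQ, hQ'⟩ := Ideal.exists_ideal_over_prime_of_isIntegral (S := F) x.asIdeal ⊥
        (by rw [← RingHom.ker_eq_comap_bot, (RingHom.injective_iff_ker_eq_bot _).1 hinj]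
            exact bot_le)
      exact ⟨RelSeries.singleton _ ⟨Q, hQ⟩, rfl, PrimeSpectrum.ext hQ'⟩
    | snoc p x hx hp =>
      obtain ⟨l', h1, h2⟩ := hp
      have hx' : p.last < x := hx
      obtain ⟨Q, hge, hQ, hQ'⟩ := Ideal.exists_ideal_over_prime_of_isIntegral_of_isPrime (S := F)
        x.asIdeal l'.last.asIdeal (by
          have := congrArg PrimeSpectrum.asIdeal h2
          rw [PrimeSpectrum.comap_asIdeal] at this
          rw [this]; exact hx'.le)
      have hlt : l'.last < (⟨Q, hQ⟩ : PrimeSpectrum F) := by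
        refine lt_of_le_of_ne hge ?_
        intro h
        rw [h] at h2
        apply hx'.ne
        rw [← h2]
        exact PrimeSpectrum.ext hQ'
      refine ⟨RelSeries.snoc l' ⟨Q, hQ⟩ hlt, ?_, ?_⟩
      · simp [h1]
      · rw [RelSeries.last_snoc, RelSeries.last_snoc]
        exact PrimeSpectrum.ext hQ'
  obtain ⟨l', h1, -⟩ := key l
  rw [← h1]
  exact le_iSup (fun p : LTSeries (PrimeSpectrum F) => (p.length : WithBot ℕ∞)) l'

section Abs
open Polynomial IsLocalRing
variable {R A : Type*} [CommRing R] [CommRing A] [Algebra R A] {M : Submodule R A}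
  (ψ : A →ₐ[R] A[X]) (hψ : ∀ m ∈ M, ψ m = C m * X) (hadj : Algebra.adjoin R (M : Set A) = ⊤)

include hψ in
theorem psi_pow (j : ℕ) : ∀ a ∈ M ^ j, ψ a = C a * X ^ j := by
  induction j with
  | zero =>
    intro a ha
    rw [pow_zero, Submodule.mem_one] at ha
    obtain ⟨r, rfl⟩ := ha
    rw [AlgHom.commutes]; simp
  | succ j ih =>
    intro a ha
    rw [pow_succ] at ha
    induction ha using Submodule.mul_induction_on' with
    | mem_mul_mem m hm n hn => rw [map_mul, ih _ hm, hψ _ hn, C_mul]; ring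
    | add x hx y hy h1 h2 => rw [map_add, h1, h2, C_add]; ring

include hψ hadj in
theorem coeff_psi_mem (a : A) : ∀ j, (ψ a).coeff j ∈ M ^ j := by
  have ha : a ∈ Algebra.adjoin R (M : Set A) := hadj ▸ Algebra.mem_top
  induction ha using Algebra.adjoin_induction with
  | mem x hx =>
    intro j
    rw [hψ x hx, coeff_C_mul, coeff_X]
    split_ifs with h
    · subst h; simpa using hx
    · simp
  | algebraMap r =>
    intro j
    rw [AlgHom.commutes, Polynomial.algebraMap_apply, coeff_C]
    split_ifs with h
    · subst h; rw [pow_zero]; exact Submodule.algebraMap_mem r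
    · simp
  | add x y _ _ h1 h2 => intro j; rw [map_add, coeff_add]; exact add_mem (h1 j) (h2 j)
  | mul x y _ _ h1 h2 =>
    intro j
    rw [map_mul, coeff_mul]
    refine sum_mem fun p hp => ?_
    rw [← Finset.HasAntidiagonal.mem_antidiagonal.1 hp, pow_add]
    exact Submodule.mul_mem_mul (h1 _) (h2 _)

include hψ hadj in
theorem eval_psi (a : A) : (ψ a).eval 1 = a := by
  have ha : a ∈ Algebra.adjoin R (M : Set A) := hadj ▸ Algebra.mem_top
  induction ha using Algebra.adjoin_induction with
  | mem x hx => rw [hψ x hx]; simp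
  | algebraMap r => rw [AlgHom.commutes, Polynomial.algebraMap_apply, eval_C]
  | add x y _ _ h1 h2 => rw [map_add, eval_add, h1, h2]
  | mul x y _ _ h1 h2 => rw [map_mul, eval_mul, h1, h2]

variable [IsLocalRing R]

include hψ hadj in
theorem coeff_psi_ideal {U : Submodule R A} (hU : U ≤ M) (r : ℕ) (a : A)
    (ha : a ∈ Ideal.span (U : Set A) ⊔ (maximalIdeal R).map (algebraMap R A)) :
    (ψ a).coeff (r + 1) ∈ U * M ^ r ⊔ maximalIdeal R • M ^ (r + 1) := by
  obtain ⟨x, hx, y, hy, rfl⟩ := Submodule.mem_sup.1 ha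
  clear ha
  rw [map_add, coeff_add]
  refine Submodule.add_mem_sup ?_ ?_
  · refine Submodule.closure_induction (p := fun x _ => (ψ x).coeff (r + 1) ∈ U * M ^ r)
      (by simp) ?_ ?_ hx
    · intro x y _ _ h1 h2
      rw [map_add, coeff_add]
      exact add_mem h1 h2
    · intro a u hu
      rw [smul_eq_mul, mul_comm a u, map_mul, hψ u (hU hu), mul_assoc, coeff_C_mul, coeff_X_mul]
      exact Submodule.mul_mem_mul hu (coeff_psi_mem ψ hψ hadj a r)
  · refine Submodule.closure_induction
      (p := fun x _ => (ψ x).coeff (r + 1) ∈ maximalIdeal R • M ^ (r + 1))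
      (by simp) ?_ ?_ hy
    · intro x y _ _ h1 h2
      rw [map_add, coeff_add]
      exact add_mem h1 h2
    · rintro a _ ⟨m, hm, rfl⟩
      rw [smul_eq_mul, mul_comm, ← Algebra.smul_def, map_smul, coeff_smul]
      exact Submodule.smul_mem_smul hm (coeff_psi_mem ψ hψ hadj a (r + 1))

include hψ hadj in
theorem reduction_of_radical (hfg : M.FG) {U : Submodule R A} (hU : U ≤ M)
    (h : (M : Set A) ⊆ (Ideal.span (U : Set A) ⊔ (maximalIdeal R).map (algebraMap R A)).radical) :
    ∃ r, M ^ (r + 1) = U * M ^ r := by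
  have hfg' : (Ideal.span (M : Set A)).FG := by
    obtain ⟨s, hs⟩ := hfg
    refine ⟨s, le_antisymm (Submodule.span_mono ?_) (Submodule.span_le.2 ?_)⟩
    · rw [← hs]; exact Submodule.subset_span
    · rw [← hs]; exact Submodule.span_le_restrictScalars R A _
  obtain ⟨N, hN⟩ := Ideal.exists_pow_le_of_le_radical_of_fg (Ideal.span_le.2 h) hfg'
  have hMN : ∀ j, ∀ a ∈ M ^ j, a ∈ Ideal.span (M : Set A) ^ j := by
    intro j
    induction j with
    | zero => intro a _; simp
    | succ j ih =>
      intro a ha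
      rw [pow_succ] at ha ⊢
      induction ha using Submodule.mul_induction_on' with
      | mem_mul_mem m hm n hn => exact Ideal.mul_mem_mul (ih _ hm) (Ideal.subset_span hn)
      | add x hx y hy h1 h2 => exact add_mem h1 h2
  refine ⟨N, le_antisymm ?_ ?_⟩
  · refine Submodule.le_of_le_smul_of_le_jacobson_bot (I := maximalIdeal R) (hfg.pow _)
      (maximalIdeal_le_jacobson _) ?_
    intro a ha
    have := coeff_psi_ideal ψ hψ hadj hU N a (hN (Ideal.pow_le_pow_right N.le_succ (hMN _ a ha)))
    rwa [psi_pow ψ hψ _ a ha, coeff_C_mul, coeff_X_pow, if_pos rfl, mul_one] at this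
  · rw [pow_succ']
    exact mul_le_mul' hU le_rfl

omit [IsLocalRing R] in
theorem radical_of_reduction {U : Submodule R A} {r : ℕ} (h : M ^ (r + 1) ≤ U * M ^ r) :
    (M : Set A) ⊆ (Ideal.span (U : Set A)).radical := by
  intro m hm
  refine ⟨r + 1, ?_⟩
  have : m ^ (r + 1) ∈ U * M ^ r := h (Submodule.pow_mem_pow _ hm _)
  refine Submodule.mul_induction_on this ?_ fun _ _ => add_mem
  intro u hu x _
  exact Ideal.mul_mem_right _ _ (Ideal.subset_span hu)

/-- the structure map -/
def fiberHom : ResidueField R →+* A ⧸ (maximalIdeal R).map (algebraMap R A) :=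
  Ideal.Quotient.lift (maximalIdeal R)
    ((Ideal.Quotient.mk _).comp (algebraMap R A)) (fun _ ha =>
      Ideal.Quotient.eq_zero_iff_mem.2 (Ideal.mem_map_of_mem _ ha))

theorem fiberHom_residue (r : R) : fiberHom (A := A) (residue R r) =
    Ideal.Quotient.mk _ (algebraMap R A r) := rfl

/-- evaluation -/
def fiberEval {n : ℕ} (u : Fin n → A) :
    MvPolynomial (Fin n) (ResidueField R) →+* A ⧸ (maximalIdeal R).map (algebraMap R A) :=
  MvPolynomial.eval₂Hom fiberHom (fun i => Ideal.Quotient.mk _ (u i))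

theorem fiberEval_map {n : ℕ} (u : Fin n → A) (p : MvPolynomial (Fin n) R) :
    fiberEval u (MvPolynomial.map (residue R) p) =
      Ideal.Quotient.mk ((maximalIdeal R).map (algebraMap R A)) (MvPolynomial.aeval u p) := by
  rw [fiberEval, MvPolynomial.coe_eval₂Hom, MvPolynomial.eval₂_map, MvPolynomial.aeval_def,
    MvPolynomial.eval₂_comp_left]
  rfl

include hψ hadj in
theorem fiberEval_finite (hfg : M.FG) {n : ℕ} (u : Fin n → A) {r : ℕ}
    (h : M ^ (r + 1) ≤ Submodule.span R (Set.range u) * M ^ r) :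
    (fiberEval (R := R) u).Finite := by
  classical
  let J := (maximalIdeal R).map (algebraMap R A)
  let P := MvPolynomial (Fin n) (ResidueField R)
  let _ : Algebra P (A ⧸ J) := (fiberEval (R := R) u).toAlgebra
  have hsm : ∀ (p : P) (x : A ⧸ J), p • x = fiberEval u p * x := fun p x => Algebra.smul_def p x
  choose T hT using fun j => hfg.pow j
  let S : Submodule P (A ⧸ J) :=
    Submodule.span P ((Finset.range (r + 1)).biUnion (fun j => (T j).image (Ideal.Quotient.mk J)) :
      Finset (A ⧸ J))
  have hRS : ∀ (c : R) (x : A), Ideal.Quotient.mk J x ∈ S → Ideal.Quotient.mk J (c • x) ∈ S := by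
    intro c x hx
    have := S.smul_mem (MvPolynomial.map (residue R) (MvPolynomial.C c)) hx
    rw [hsm, fiberEval_map, ← map_mul] at this
    simpa [Algebra.smul_def] using this
  have h1 : ∀ j, ∀ x ∈ M ^ j, Ideal.Quotient.mk J x ∈ S := by
    intro j
    induction j with
    | zero =>
      intro x hx
      rw [← hT] at hx
      induction hx using Submodule.span_induction with
      | mem x hx =>
        refine Submodule.subset_span ?_
        simp only [Finset.coe_biUnion, Finset.coe_image, Set.mem_iUnion]
        exact ⟨0, by simp, x, hx, rfl⟩
      | zero => simp
      | add x y _ _ h1 h2 => rw [map_add]; exact add_mem h1 h2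
      | smul c x _ hx => exact hRS c x hx
    | succ j ih =>
      intro x hx
      by_cases hj : j + 1 < r + 1
      · rw [← hT] at hx
        induction hx using Submodule.span_induction with
        | mem x hx =>
          refine Submodule.subset_span ?_
          simp only [Finset.coe_biUnion, Finset.coe_image, Set.mem_iUnion]
          exact ⟨j + 1, by simpa using hj, x, hx, rfl⟩
        | zero => simp
        | add x y _ _ h1 h2 => rw [map_add]; exact add_mem h1 h2
        | smul c x _ hx => exact hRS c x hx
      · obtain ⟨i, rfl⟩ : ∃ i, j = r + i := ⟨j - r, by omega⟩
        have hx' : x ∈ Submodule.span R (Set.range u) * M ^ (r + i) := by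
          have : M ^ (r + i + 1) ≤ Submodule.span R (Set.range u) * M ^ (r + i) := by
            rw [show r + i + 1 = (r + 1) + i by ring, pow_add, pow_add M r i, ← mul_assoc]
            exact mul_le_mul' h le_rfl
          exact this hx
        refine Submodule.mul_induction_on hx' ?_ ?_
        · intro v hv y hy
          induction hv using Submodule.span_induction with
          | mem v hv =>
            obtain ⟨k, rfl⟩ := hv
            have := S.smul_mem (MvPolynomial.map (residue R) (MvPolynomial.X k)) (ih y hy)
            rw [hsm, fiberEval_map, ← map_mul] at this
            simpa using this
          | zero => simp
          | add x y _ _ h1 h2 => rw [add_mul, map_add]; exact add_mem h1 h2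
          | smul c x _ hx => rw [smul_mul_assoc]; exact hRS c _ hx
        · intro x y h1 h2
          rw [map_add]; exact add_mem h1 h2
  refine ⟨⟨_, (?_ : S = ⊤)⟩⟩
  rw [eq_top_iff]
  rintro x -
  obtain ⟨a, rfl⟩ := Ideal.Quotient.mk_surjective x
  rw [← eval_psi ψ hψ hadj a, eval_eq_sum, Polynomial.sum, map_sum]
  refine sum_mem fun j _ => ?_
  simpa using h1 j _ (coeff_psi_mem ψ hψ hadj a j)

theorem dim_mvPoly (k : Type*) [Field k] (n : ℕ) :
    ringKrullDim (MvPolynomial (Fin n) k) = n := by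
  rw [MvPolynomial.ringKrullDim_of_isNoetherianRing, ringKrullDim_eq_zero_of_field]
  simp

include hψ hadj in
theorem dim_le_gens (hfg : M.FG) {n : ℕ} (u : Fin n → A) {r : ℕ}
    (h : M ^ (r + 1) ≤ Submodule.span R (Set.range u) * M ^ r) :
    ringKrullDim (A ⧸ (maximalIdeal R).map (algebraMap R A)) ≤ n := by
  have hf := fiberEval_finite ψ hψ hadj hfg u h
  let _ := (fiberEval (R := R) u).toAlgebra
  have : Algebra.IsIntegral (MvPolynomial (Fin n) (ResidueField R))
    (A ⧸ (maximalIdeal R).map (algebraMap R A)) := ⟨hf.to_isIntegral⟩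
  rw [← dim_mvPoly (ResidueField R) n]
  exact dim_le_of_integral

include hψ hadj in
theorem exists_relation (hfg : M.FG) {n : ℕ} (u : Fin n → A) {r : ℕ}
    (h : M ^ (r + 1) ≤ Submodule.span R (Set.range u) * M ^ r)
    (hd : ¬ (n ≤ ringKrullDim (A ⧸ (maximalIdeal R).map (algebraMap R A)))) :
    ∃ g : MvPolynomial (Fin n) R, MvPolynomial.map (residue R) g ≠ 0 ∧
      MvPolynomial.aeval u g ∈ (maximalIdeal R).map (algebraMap R A) := by
  have hf := fiberEval_finite ψ hψ hadj hfg u h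
  by_contra! hcon
  apply hd
  let _ := (fiberEval (R := R) u).toAlgebra
  have : Algebra.IsIntegral (MvPolynomial (Fin n) (ResidueField R))
    (A ⧸ (maximalIdeal R).map (algebraMap R A)) := ⟨hf.to_isIntegral⟩
  rw [← dim_mvPoly (ResidueField R) n]
  apply dim_ge_of_integral
  change Function.Injective (fiberEval (R := R) u)
  rw [injective_iff_map_eq_zero]
  intro p hp
  obtain ⟨g, rfl⟩ := MvPolynomial.map_surjective _ residue_surjective p
  by_contra hne
  apply hcon g hne
  rw [fiberEval_map, Ideal.Quotient.eq_zero_iff_mem] at hp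
  exact hp

omit [IsLocalRing R] in
theorem aeval_homog_mem {n d : ℕ} (u : Fin n → A) (hu : ∀ i, u i ∈ M)
    (p : MvPolynomial (Fin n) R) (hp : p.IsHomogeneous d) : MvPolynomial.aeval u p ∈ M ^ d := by
  rw [← MvPolynomial.mem_homogeneousSubmodule, ← MvPolynomial.homogeneousSubmodule_one_pow] at hp
  have h := Submodule.mem_map_of_mem (f := (MvPolynomial.aeval (R := R) u).toLinearMap) hp
  rw [Submodule.map_pow, MvPolynomial.homogeneousSubmodule_one_eq_span_X, Submodule.map_span] at h
  refine (pow_le_pow_left' (?_ : _ ≤ M) d) h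
  rw [Submodule.span_le]
  rintro _ ⟨_, ⟨i, rfl⟩, rfl⟩
  simpa using hu i

omit [IsLocalRing R] in
theorem aeval_homog_smul {n d : ℕ} (a : Fin n → R) (y : A)
    (p : MvPolynomial (Fin n) R) (hp : p.IsHomogeneous d) :
    MvPolynomial.aeval (fun i => a i • y) p = MvPolynomial.eval a p • y ^ d := by
  rw [MvPolynomial.aeval_def, MvPolynomial.eval₂_eq', MvPolynomial.eval_eq', Finset.sum_smul]
  refine Finset.sum_congr rfl fun s hs => ?_
  have hd : ∑ i, s i = d := by
    rw [← Finsupp.degree_eq_sum, Finsupp.degree_apply, ← hp.degree_eq_sum_deg_support hs]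
  simp_rw [_root_.smul_pow]
  rw [← hd, ← Finset.prod_pow_eq_pow_sum, mul_smul, Algebra.smul_def (p.coeff s)]
  congr 1
  simp_rw [Algebra.smul_def]
  rw [Finset.prod_mul_distrib, map_prod]

include hψ in
theorem aeval_homogComp_mem {n : ℕ} (u : Fin n → A) (hu : ∀ i, u i ∈ M)
    (g : MvPolynomial (Fin n) R)
    (hg : MvPolynomial.aeval u g ∈ (maximalIdeal R).map (algebraMap R A)) (d : ℕ) :
    MvPolynomial.aeval u (MvPolynomial.homogeneousComponent d g) ∈
      (maximalIdeal R).map (algebraMap R A) := by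
  have h1 : ∀ a ∈ (maximalIdeal R).map (algebraMap R A), ∀ j,
      (ψ a).coeff j ∈ (maximalIdeal R).map (algebraMap R A) := by
    intro a ha j
    refine Submodule.closure_induction
      (p := fun x _ => (ψ x).coeff j ∈ (maximalIdeal R).map (algebraMap R A))
      (by simp) ?_ ?_ ha
    · intro x y _ _ h1 h2
      rw [map_add, coeff_add]
      exact add_mem h1 h2
    · rintro a _ ⟨m, hm, rfl⟩
      rw [smul_eq_mul, mul_comm, ← Algebra.smul_def, map_smul, coeff_smul, Algebra.smul_def]
      exact Ideal.mul_mem_right _ _ (Ideal.mem_map_of_mem _ hm)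
  have h2 := h1 _ hg d
  rw [← MvPolynomial.sum_homogeneousComponent g, map_sum, map_sum, finsetSum_coeff] at h2
  have h3 : ∀ e, (ψ (MvPolynomial.aeval u (MvPolynomial.homogeneousComponent e g))).coeff d =
      if e = d then MvPolynomial.aeval u (MvPolynomial.homogeneousComponent d g) else 0 := by
    intro e
    rw [psi_pow ψ hψ e _ (aeval_homog_mem u hu _
      (MvPolynomial.homogeneousComponent_isHomogeneous e g)), coeff_C_mul, coeff_X_pow]
    by_cases h : e = d
    · subst h; simp
    · rw [if_neg h, if_neg (Ne.symm h), mul_zero]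
  simp_rw [h3] at h2
  rw [Finset.sum_ite_eq'] at h2
  split_ifs at h2 with h
  · exact h2
  · rw [MvPolynomial.homogeneousComponent_eq_zero]
    · simp
    · simpa using h

include hψ in
theorem exists_fewer [Infinite (ResidueField R)] {n : ℕ} (u : Fin (n + 1) → A)
    (hu : ∀ i, u i ∈ M)
    (hr : (M : Set A) ⊆ (Ideal.span (Submodule.span R (Set.range u) : Set A)).radical)
    (hg : ∃ g : MvPolynomial (Fin (n + 1)) R, MvPolynomial.map (residue R) g ≠ 0 ∧
      MvPolynomial.aeval u g ∈ (maximalIdeal R).map (algebraMap R A)) :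
    ∃ c : Fin n → R, (M : Set A) ⊆
      (Ideal.span (Submodule.span R (Set.range fun j : Fin n => u j.succ - c j • u 0) : Set A) ⊔
        (maximalIdeal R).map (algebraMap R A)).radical := by
  obtain ⟨g, hg0, hgJ⟩ := hg
  obtain ⟨s, hs⟩ := MvPolynomial.ne_zero_iff.1 hg0
  set d := s.degree with hd
  set h := MvPolynomial.homogeneousComponent d g with hh
  have hhom : h.IsHomogeneous d := MvPolynomial.homogeneousComponent_isHomogeneous d g
  have hJ := aeval_homogComp_mem ψ hψ u hu g hgJ d
  have hh0 : MvPolynomial.map (residue R) h ≠ 0 := by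
    refine MvPolynomial.ne_zero_iff.2 ⟨s, ?_⟩
    rw [MvPolynomial.coeff_map] at hs ⊢
    rwa [hh, MvPolynomial.coeff_homogeneousComponent, if_pos hd.symm]
  obtain ⟨b, hb⟩ : ∃ b : Fin (n + 1) → ResidueField R,
      MvPolynomial.eval b (MvPolynomial.map (residue R) h * MvPolynomial.X 0) ≠ 0 := by
    by_contra! hcon
    have : MvPolynomial.map (residue R) h * MvPolynomial.X 0 = 0 :=
      MvPolynomial.funext fun x => by rw [hcon x, map_zero]
    exact mul_ne_zero hh0 (MvPolynomial.X_ne_zero 0) this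
  choose a ha using fun i => residue_surjective (b i)
  obtain rfl : b = fun i => residue R (a i) := funext fun i => (ha i).symm
  rw [map_mul, MvPolynomial.eval_X, mul_ne_zero_iff] at hb
  obtain ⟨hb1, hb2⟩ := hb
  have ha0 : IsUnit (a 0) := (residue_ne_zero_iff_isUnit _).1 hb2
  have hah : IsUnit (MvPolynomial.eval a h) := by
    rw [← residue_ne_zero_iff_isUnit]
    convert hb1 using 1
    rw [MvPolynomial.eval_map, ← MvPolynomial.eval₂_id, MvPolynomial.eval₂_comp_left]
    rfl
  obtain ⟨v, hv⟩ := ha0.exists_right_inv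
  obtain ⟨w, hw⟩ := hah.exists_left_inv
  refine ⟨fun j => a j.succ * v, ?_⟩
  set I := Ideal.span (Submodule.span R
    (Set.range fun j : Fin n => u j.succ - (a j.succ * v) • u 0) : Set A) ⊔
        (maximalIdeal R).map (algebraMap R A) with hI
  set y := v • u 0 with hy
  have hdiff : ∀ i, u i - a i • y ∈ I := by
    intro i
    refine Fin.cases ?_ (fun j => ?_) i
    · rw [hy, smul_smul, hv, one_smul, sub_self]; exact zero_mem _
    · refine Ideal.mem_sup_left (Ideal.subset_span (Submodule.subset_span ⟨j, ?_⟩))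
      simp only [hy, smul_smul]
  have hyd : y ^ d ∈ I := by
    have e1 : MvPolynomial.aeval u h - MvPolynomial.aeval (fun i => a i • y) h ∈ I := by
      rw [← Ideal.Quotient.mk_eq_mk_iff_sub_mem]
      have e2 : ∀ z : Fin (n + 1) → A, Ideal.Quotient.mk I (MvPolynomial.aeval z h) =
          MvPolynomial.eval₂ ((Ideal.Quotient.mk I).comp (algebraMap R A))
            (fun i => Ideal.Quotient.mk I (z i)) h := by
        intro z
        rw [MvPolynomial.aeval_def, MvPolynomial.eval₂_comp_left]
        rfl
      rw [e2, e2]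
      congr 1
      funext i
      exact (Ideal.Quotient.mk_eq_mk_iff_sub_mem _ _).2 (hdiff i)
    rw [aeval_homog_smul a y h hhom] at e1
    have e3 : MvPolynomial.eval a h • y ^ d ∈ I := by
      have := sub_mem (Ideal.mem_sup_right hJ : MvPolynomial.aeval u h ∈ I) e1
      rwa [sub_sub_cancel] at this
    have e4 := I.mul_mem_left (algebraMap R A w) e3
    rwa [← Algebra.smul_def, smul_smul, hw, one_smul] at e4
  have hyr : y ∈ I.radical := ⟨d, hyd⟩
  have hur : ∀ i, u i ∈ I.radical := by
    intro i
    have := add_mem (Ideal.le_radical (hdiff i)) (I.radical.mul_mem_left (algebraMap R A (a i)) hyr)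
    rwa [← Algebra.smul_def, sub_add_cancel] at this
  refine hr.trans ?_
  rw [SetLike.coe_subset_coe, ← Ideal.radical_idem I]
  refine Ideal.radical_mono (Ideal.span_le.2 ?_)
  have : Submodule.span R (Set.range u) ≤ I.radical.restrictScalars R := by
    rw [Submodule.span_le]
    rintro _ ⟨i, rfl⟩
    exact hur i
  exact this

end Abs
section Bridge
set_option linter.unusedSectionVars false
open Polynomial IsLocalRing
variable (R : Type u) [CommRing R] (E : Type u) [AddCommGroup E] [Module R E]

/-- The linear map `E → R(E)`. -/
def reesLin : E →ₗ[R] ReesModAlg R E where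
  toFun := reesι R E
  map_add' x y := by
    unfold reesι
    rw [← map_add, ← map_add]
    congr 1
    refine Ideal.Quotient.eq.2 (Ideal.subset_span (Or.inl ⟨x, y, ?_⟩))
    ring
  map_smul' r x := by
    have h : (Ideal.Quotient.mk (Ideal.span (symRels R E)) (MvPolynomial.X (r • x))) =
        Ideal.Quotient.mk _ (MvPolynomial.C r * MvPolynomial.X x) :=
      Ideal.Quotient.eq.2 (Ideal.subset_span (Or.inr ⟨r, x, rfl⟩))
    unfold reesι
    rw [h, RingHom.id_apply, ← MvPolynomial.smul_eq_C_mul]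
    rfl

theorem reesLin_apply (x : E) : reesLin R E x = reesι R E x := rfl

theorem rees_torsionFree (r : R) (hr : r ∈ nonZeroDivisors R) (a : ReesModAlg R E)
    (h : r • a = 0) : a = 0 := by
  obtain ⟨b, rfl⟩ := Ideal.Quotient.mk_surjective a
  have h' : r • b ∈ torsionIdeal R (SymModAlg R E) := by
    rw [← Ideal.Quotient.eq_zero_iff_mem]
    exact h
  obtain ⟨s, hs, hsb⟩ := h'
  refine Ideal.Quotient.eq_zero_iff_mem.2 ⟨s * r, mul_mem hs hr, ?_⟩
  rw [mul_smul, hsb]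

/-- Universal property of the Rees algebra for torsion-free algebras. -/
def reesLift (B : Type u) [CommRing B] [Algebra R B]
    (hB : ∀ r ∈ nonZeroDivisors R, ∀ b : B, r • b = 0 → b = 0) (f : E →ₗ[R] B) :
    ReesModAlg R E →ₐ[R] B :=
  Ideal.Quotient.liftₐ _ (Ideal.Quotient.liftₐ (Ideal.span (symRels R E))
    (MvPolynomial.aeval (fun e => f e)) (by
      intro a ha
      have : Ideal.span (symRels R E) ≤ RingHom.ker (MvPolynomial.aeval (R := R) (fun e => f e)) := by
        rw [Ideal.span_le]
        rintro _ (⟨x, y, rfl⟩ | ⟨r, x, rfl⟩)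
        · simp [RingHom.mem_ker]
        · simp [RingHom.mem_ker, Algebra.smul_def]
      exact this ha)) (by
      rintro a ⟨r, hr, ha⟩
      refine hB r hr _ ?_
      rw [← map_smul, ha, map_zero])

theorem reesLift_ι (B : Type u) [CommRing B] [Algebra R B]
    (hB : ∀ r ∈ nonZeroDivisors R, ∀ b : B, r • b = 0 → b = 0) (f : E →ₗ[R] B) (x : E) :
    reesLift R E B hB f (reesLin R E x) = f x := by
  change MvPolynomial.aeval (fun e => f e) (MvPolynomial.X x : MvPolynomial E R) = f x
  simp

/-- The grading homomorphism. -/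
def reesPsi : ReesModAlg R E →ₐ[R] (ReesModAlg R E)[X] :=
  reesLift R E _ (by
    intro r hr b hb
    ext j
    refine rees_torsionFree R E r hr _ ?_
    rw [← coeff_smul, hb, coeff_zero])
    ((LinearMap.mulRight R (X : (ReesModAlg R E)[X])).comp
      (((Algebra.ofId (ReesModAlg R E) (ReesModAlg R E)[X]).toLinearMap.restrictScalars R).comp
        (reesLin R E)))

theorem reesPsi_mem : ∀ m ∈ LinearMap.range (reesLin R E), reesPsi R E m = C m * X := by
  rintro _ ⟨x, rfl⟩
  rw [reesPsi, reesLift_ι]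
  rfl

theorem rees_adjoin : Algebra.adjoin R (LinearMap.range (reesLin R E) : Set (ReesModAlg R E)) = ⊤ := by
  rw [eq_top_iff]
  rintro a -
  obtain ⟨b, rfl⟩ := Ideal.Quotient.mk_surjective a
  obtain ⟨p, rfl⟩ := Ideal.Quotient.mk_surjective b
  induction p using MvPolynomial.induction_on with
  | C r => exact Subalgebra.algebraMap_mem _ r
  | add p q hp hq => rw [map_add, map_add]; exact add_mem hp hq
  | mul_X p x hp =>
    rw [map_mul, map_mul]
    exact mul_mem hp (Algebra.subset_adjoin ⟨x, rfl⟩)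

theorem reesPower_eq (j : ℕ) : reesPower R E j = LinearMap.range (reesLin R E) ^ j := by
  have : LinearMap.range (reesLin R E) = Submodule.span R (Set.range (reesι R E)) := by
    refine (Submodule.span_eq _).symm.trans ?_
    rfl
  rw [this, Submodule.span_pow, reesPower]
  congr 1
  ext a
  rw [Set.mem_pow]
  constructor
  · rintro ⟨f, rfl⟩
    exact ⟨fun i => ⟨_, f i, rfl⟩, by rw [List.prod_ofFn]⟩
  · rintro ⟨f, rfl⟩
    choose g hg using fun i => (f i).2
    refine ⟨g, ?_⟩
    rw [List.prod_ofFn]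
    exact Finset.prod_congr rfl fun i _ => (hg i).symm

theorem mulPower_eq (U : Submodule R E) (r : ℕ) :
    mulPower R E U r = U.map (reesLin R E) * LinearMap.range (reesLin R E) ^ r := by
  rw [← reesPower_eq, reesPower]
  have : U.map (reesLin R E) = Submodule.span R (reesι R E '' U) :=
    (Submodule.span_eq _).symm
  rw [this, Submodule.span_mul_span, mulPower]
  congr 1
  ext a
  rw [Set.mem_mul]
  constructor
  · rintro ⟨u, hu, f, rfl⟩
    exact ⟨_, ⟨u, hu, rfl⟩, _, ⟨f, rfl⟩, rfl⟩
  · rintro ⟨_, ⟨u, hu, rfl⟩, _, ⟨f, rfl⟩, rfl⟩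
    exact ⟨u, hu, f, rfl⟩

theorem isReduction_iff (U : Submodule R E) : IsReduction R E U ↔
    ∃ r, LinearMap.range (reesLin R E) ^ (r + 1) =
      U.map (reesLin R E) * LinearMap.range (reesLin R E) ^ r := by
  simp only [IsReduction, reesPower_eq, mulPower_eq]

variable [IsLocalRing R]

theorem fiber_nontrivial : Nontrivial (ReesModAlg R E ⧸ fiberIdeal R E) := by
  rw [Ideal.Quotient.nontrivial_iff]
  intro htop
  let ε : ReesModAlg R E →ₐ[R] R := reesLift R E R
    (fun r hr b hb => (mul_left_mem_nonZeroDivisors_eq_zero_iff hr).1 hb) 0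
  have h : fiberIdeal R E ≤ (maximalIdeal R).comap ε := by
    refine Ideal.map_le_iff_le_comap.2 fun r hr => ?_
    rw [Ideal.mem_comap, Ideal.mem_comap, AlgHom.commutes]
    exact hr
  rw [htop, top_le_iff, Ideal.eq_top_iff_one, Ideal.mem_comap, map_one] at h
  exact (Ideal.ne_top_iff_one _).1 (maximalIdeal.isMaximal R).ne_top h

variable [Module.Finite R E]

theorem range_fg : (LinearMap.range (reesLin R E)).FG := by
  rw [LinearMap.range_eq_map]
  exact Module.Finite.fg_top.map _

theorem map_le_range (U : Submodule R E) :
    U.map (reesLin R E) ≤ LinearMap.range (reesLin R E) := LinearMap.map_le_range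

theorem isReduction_iff_radical (U : Submodule R E) : IsReduction R E U ↔
    (LinearMap.range (reesLin R E) : Set (ReesModAlg R E)) ⊆
      (Ideal.span (U.map (reesLin R E) : Set (ReesModAlg R E)) ⊔ fiberIdeal R E).radical := by
  rw [isReduction_iff]
  constructor
  · rintro ⟨r, hr⟩
    exact (radical_of_reduction hr.le).trans (Ideal.radical_mono le_sup_left)
  · intro h
    exact reduction_of_radical (reesPsi R E) (reesPsi_mem R E) (rees_adjoin R E) (range_fg R E)
      (map_le_range R E U) h

theorem map_span_range {n : ℕ} (u : Fin n → E) :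
    (Submodule.span R (Set.range u)).map (reesLin R E) =
      Submodule.span R (Set.range fun i => reesLin R E (u i)) := by
  rw [Submodule.map_span, ← Set.range_comp]
  rfl

theorem spread_le {n : ℕ} (u : Fin n → E) (h : IsReduction R E (Submodule.span R (Set.range u))) :
    analyticSpread R E ≤ n := by
  rw [isReduction_iff, map_span_range] at h
  obtain ⟨r, hr⟩ := h
  exact dim_le_gens (reesPsi R E) (reesPsi_mem R E) (rees_adjoin R E) (range_fg R E) _ hr.le

theorem exists_fewer' [Infinite (ResidueField R)] {n : ℕ} (u : Fin (n + 1) → E)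
    (h : IsReduction R E (Submodule.span R (Set.range u)))
    (hd : ¬ (((n + 1 : ℕ) : WithBot ℕ∞) ≤ analyticSpread R E)) :
    ∃ c : Fin n → R, IsReduction R E
      (Submodule.span R (Set.range fun j : Fin n => u j.succ - c j • u 0)) := by
  rw [isReduction_iff, map_span_range] at h
  obtain ⟨r, hr⟩ := h
  have hg := exists_relation (reesPsi R E) (reesPsi_mem R E) (rees_adjoin R E) (range_fg R E) _
    hr.le hd
  obtain ⟨c, hc⟩ := exists_fewer (reesPsi R E) (reesPsi_mem R E) _
    (fun i => LinearMap.mem_range_self _ _) (radical_of_reduction hr.le) hg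
  refine ⟨c, ?_⟩
  rw [isReduction_iff_radical, map_span_range]
  simp only [map_sub, map_smul]
  exact hc

theorem exists_good [IsNoetherianRing R] [Infinite (ResidueField R)] (U : Submodule R E)
    (hU : IsReduction R E U) : ∃ (n : ℕ) (u : Fin n → E), (∀ i, u i ∈ U) ∧
      IsReduction R E (Submodule.span R (Set.range u)) ∧ analyticSpread R E = n := by
  classical
  have hex : ∃ n : ℕ, ∃ u : Fin n → E, (∀ i, u i ∈ U) ∧
      IsReduction R E (Submodule.span R (Set.range u)) := by
    obtain ⟨n, u, hu⟩ := Submodule.fg_iff_exists_fin_generating_family.1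
      (IsNoetherian.noetherian U)
    refine ⟨n, u, fun i => ?_, hu ▸ hU⟩
    rw [← hu]; exact Submodule.subset_span ⟨i, rfl⟩
  obtain ⟨u, hu, hr⟩ := Nat.find_spec hex
  have hmin := fun m => Nat.find_min hex (m := m)
  generalize Nat.find hex = n at *
  refine ⟨n, u, hu, hr, le_antisymm (spread_le R E u hr) ?_⟩
  cases n with
  | zero =>
    have := fiber_nontrivial R E
    exact ringKrullDim_nonneg_of_nontrivial
  | succ n =>
    by_contra hd
    obtain ⟨c, hc⟩ := exists_fewer' R E u hr hd
    exact hmin n n.lt_succ_self ⟨_, fun j => sub_mem (hu _) (U.smul_mem _ (hu _)), hc⟩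

omit [IsLocalRing R] in
theorem minGens_spec : ∃ f : Fin (minGens R E) → E, Submodule.span R (Set.range f) = ⊤ :=
  Nat.sInf_mem (s := {n | ∃ f : Fin n → E, Submodule.span R (Set.range f) = ⊤})
    (Submodule.fg_iff_exists_fin_generating_family.1 Module.Finite.fg_top)

omit [IsLocalRing R] [Module.Finite R E] in
theorem minGens_le {n : ℕ} (f : Fin n → E) (h : Submodule.span R (Set.range f) = ⊤) :
    minGens R E ≤ n := Nat.sInf_le ⟨f, h⟩

theorem isReduction_top : IsReduction R E ⊤ := by
  rw [isReduction_iff]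
  refine ⟨0, ?_⟩
  rw [Submodule.map_top]
  simp

theorem isReduction_congr {U U' : Submodule R E} (h : U ≤ U' ⊔ maximalIdeal R • ⊤)
    (hU : IsReduction R E U) : IsReduction R E U' := by
  rw [isReduction_iff_radical] at hU ⊢
  refine hU.trans (Ideal.radical_mono (sup_le ?_ le_sup_right))
  rw [Ideal.span_le]
  rintro _ ⟨x, hx, rfl⟩
  obtain ⟨y, hy, z, hz, rfl⟩ := Submodule.mem_sup.1 (h hx)
  rw [map_add]
  refine add_mem (Ideal.mem_sup_left (Ideal.subset_span ⟨y, hy, rfl⟩)) (Ideal.mem_sup_right ?_)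
  refine Submodule.smul_induction_on hz ?_ ?_
  · intro r hr n _
    rw [map_smul, Algebra.smul_def]
    exact Ideal.mul_mem_right _ _ (Ideal.mem_map_of_mem _ hr)
  · intro x y hx hy
    rw [map_add]; exact add_mem hx hy

theorem exists_smaller (U : Submodule R E) (hU : IsReduction R E U) (hne : U ≠ ⊤) :
    ∃ (n : ℕ) (u : Fin n → E), n < minGens R E ∧
      IsReduction R E (Submodule.span R (Set.range u)) := by
  let _ : Field (R ⧸ maximalIdeal R) := Ideal.Quotient.field _
  let q : E →ₗ[R] E ⧸ (maximalIdeal R • ⊤ : Submodule R E) := Submodule.mkQ _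
  have hq : ∀ (r : R) (x : E), (Ideal.Quotient.mk (maximalIdeal R) r) • q x = q (r • x) :=
    fun r x => rfl
  have hspan : ∀ {n : ℕ} (g : Fin n → E), ∀ v ∈ Submodule.span (R ⧸ maximalIdeal R)
      (Set.range fun i => q (g i)), ∃ x ∈ Submodule.span R (Set.range g), q x = v := by
    intro n g v hv
    induction hv using Submodule.span_induction with
    | mem v hv =>
      obtain ⟨i, rfl⟩ := hv
      exact ⟨g i, Submodule.subset_span ⟨i, rfl⟩, rfl⟩
    | zero => exact ⟨0, zero_mem _, map_zero _⟩
    | add v w _ _ h1 h2 =>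
      obtain ⟨x, hx, rfl⟩ := h1
      obtain ⟨y, hy, rfl⟩ := h2
      exact ⟨x + y, add_mem hx hy, map_add _ _ _⟩
    | smul c v _ h1 =>
      obtain ⟨x, hx, rfl⟩ := h1
      obtain ⟨r, rfl⟩ := Ideal.Quotient.mk_surjective c
      exact ⟨r • x, Submodule.smul_mem _ _ hx, (hq r x).symm⟩
  let W : Submodule (R ⧸ maximalIdeal R) (E ⧸ (maximalIdeal R • ⊤ : Submodule R E)) :=
    { carrier := q '' U
      zero_mem' := ⟨0, zero_mem _, map_zero _⟩
      add_mem' := by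
        rintro _ _ ⟨x, hx, rfl⟩ ⟨y, hy, rfl⟩
        exact ⟨x + y, add_mem hx hy, map_add _ _ _⟩
      smul_mem' := by
        rintro c _ ⟨x, hx, rfl⟩
        obtain ⟨r, rfl⟩ := Ideal.Quotient.mk_surjective c
        exact ⟨r • x, U.smul_mem _ hx, (hq r x).symm⟩ }
  obtain ⟨f, hf⟩ := minGens_spec R E
  have hftop : Submodule.span (R ⧸ maximalIdeal R) (Set.range fun i => q (f i)) = ⊤ := by
    rw [eq_top_iff]
    rintro v -
    obtain ⟨x, rfl⟩ := Submodule.mkQ_surjective _ v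
    have hx : x ∈ Submodule.span R (Set.range f) := hf ▸ Submodule.mem_top
    induction hx using Submodule.span_induction with
    | mem x hx =>
      obtain ⟨i, rfl⟩ := hx
      exact Submodule.subset_span ⟨i, rfl⟩
    | zero => rw [map_zero]; exact zero_mem _
    | add x y _ _ h1 h2 => rw [map_add]; exact add_mem h1 h2
    | smul r x _ h1 => exact Submodule.smul_mem _ (Ideal.Quotient.mk (maximalIdeal R) r) h1
  have hfin : Module.Finite (R ⧸ maximalIdeal R) (E ⧸ (maximalIdeal R • ⊤ : Submodule R E)) :=
    ⟨hftop ▸ Submodule.fg_span (Set.finite_range _)⟩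
  have hle : Module.finrank (R ⧸ maximalIdeal R) (E ⧸ (maximalIdeal R • ⊤ : Submodule R E)) ≤
      minGens R E := by
    have h := finrank_range_le_card (R := R ⧸ maximalIdeal R) (fun i => q (f i))
    rw [Set.finrank, hftop, finrank_top, Fintype.card_fin] at h
    exact h
  have hWne : W < ⊤ := by
    rw [lt_top_iff_ne_top]
    intro hW
    apply hne
    rw [eq_top_iff]
    refine Submodule.le_of_le_smul_of_le_jacobson_bot (I := maximalIdeal R) Module.Finite.fg_top
      (maximalIdeal_le_jacobson _) ?_
    rintro x -
    obtain ⟨y, hy, hxy⟩ : q x ∈ W := hW ▸ Submodule.mem_top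
    have : x - y ∈ (maximalIdeal R • ⊤ : Submodule R E) := (Submodule.Quotient.eq _).1 hxy.symm
    rw [← add_sub_cancel y x]
    exact Submodule.add_mem_sup hy this
  have hlt := Submodule.finrank_lt hWne.ne
  let b := Module.finBasis (R ⧸ maximalIdeal R) W
  choose u hu hub using fun i => (b i).2
  refine ⟨_, u, hlt.trans_le hle, isReduction_congr R E ?_ hU⟩
  intro x hx
  have hxW : q x ∈ W := ⟨x, hx, rfl⟩
  have hx' : q x ∈ Submodule.span (R ⧸ maximalIdeal R) (Set.range fun i => q (u i)) := by
    have h1 : (⟨q x, hxW⟩ : W) ∈ Submodule.span (R ⧸ maximalIdeal R) (Set.range b) := by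
      rw [b.span_eq]; exact Submodule.mem_top
    have h2 := Submodule.mem_map_of_mem (f := W.subtype) h1
    rw [Submodule.map_span, ← Set.range_comp] at h2
    have h3 : (fun i => q (u i)) = W.subtype ∘ b := funext hub
    rw [h3]
    exact h2
  obtain ⟨y, hy, hxy⟩ := hspan u _ hx'
  have : x - y ∈ (maximalIdeal R • ⊤ : Submodule R E) := (Submodule.Quotient.eq _).1 hxy.symm
  rw [← add_sub_cancel y x]
  exact Submodule.add_mem_sup hy this

theorem minGens_submodule_spec (U : Submodule R E) [IsNoetherianRing R] :
    ∃ f : Fin (minGens R U) → E, Submodule.span R (Set.range f) = U := by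
  obtain ⟨f, hf⟩ := minGens_spec R U
  refine ⟨fun i => f i, ?_⟩
  have := congrArg (Submodule.map U.subtype) hf
  rw [Submodule.map_span, ← Set.range_comp, Submodule.map_top, Submodule.range_subtype] at this
  exact this

theorem minGens_submodule_le (U : Submodule R E) {n : ℕ} (f : Fin n → E)
    (hf : Submodule.span R (Set.range f) = U) : minGens R U ≤ n := by
  have hm : ∀ i, f i ∈ U := fun i => hf ▸ Submodule.subset_span ⟨i, rfl⟩
  refine minGens_le R U (fun i => ⟨f i, hm i⟩) ?_
  apply Submodule.map_injective_of_injective U.injective_subtype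
  rw [Submodule.map_span, ← Set.range_comp, Submodule.map_top, Submodule.range_subtype]
  exact hf

end Bridge
/-- Over a Noetherian local ring with infinite residue field:
(a) every minimal reduction of `E` has `μ = ℓ(E)`; (b) `ℓ(E) ≤ μ(E)`, with equality iff
`E` has no proper reductions. -/
theorem statement_19 (R : Type u) [CommRing R] [IsLocalRing R] [IsNoetherianRing R]
    [Infinite (IsLocalRing.ResidueField R)]
    (E : Type u) [AddCommGroup E] [Module R E] [Module.Finite R E] :
    (∀ U : Submodule R E, IsMinimalReduction R E U →
      (minGens R ↥U : WithBot ℕ∞) = analyticSpread R E) ∧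
    analyticSpread R E ≤ (minGens R E : WithBot ℕ∞) ∧
    (analyticSpread R E = (minGens R E : WithBot ℕ∞) ↔
      ∀ U : Submodule R E, IsReduction R E U → U = ⊤) := by
  refine ⟨?_, ?_, ?_, ?_⟩
  · intro U hU
    obtain ⟨n, u, hu, hr, hn⟩ := exists_good R E U hU.1
    have hspan : Submodule.span R (Set.range u) = U := hU.2 _ (Submodule.span_le.2 (by
      rintro _ ⟨i, rfl⟩; exact hu i)) hr
    obtain ⟨f, hf⟩ := minGens_submodule_spec R E U
    have hfr : IsReduction R E (Submodule.span R (Set.range f)) := by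
      rw [hf]; exact hU.1
    refine le_antisymm ?_ (spread_le R E f hfr)
    rw [hn]
    exact_mod_cast minGens_submodule_le R E U u hspan
  · obtain ⟨f, hf⟩ := minGens_spec R E
    exact spread_le R E f (hf ▸ isReduction_top R E)
  · intro h U hU
    by_contra hne
    obtain ⟨n, u, hn, hr⟩ := exists_smaller R E U hU hne
    have := spread_le R E u hr
    rw [h] at this
    have h' : minGens R E ≤ n := by exact_mod_cast this
    omega
  · intro h
    obtain ⟨n, u, hu, hr, hn⟩ := exists_good R E ⊤ (isReduction_top R E)
    obtain ⟨f, hf⟩ := minGens_spec R E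
    refine le_antisymm (spread_le R E f (hf ▸ isReduction_top R E)) ?_
    rw [hn]
    exact_mod_cast minGens_le R E u (h _ hr)
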